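/- Let h ∈ ℝ[x₁,…,x_m] be a degree-d polynomial hyperbolic with respect to e ∈ Γ₊₊, let μ be a d_μ-homogeneous strongly Rayleigh probability distribution on subsets of [n] with generating polynomial g_μ, and let v₁,…,vₙ ∈ Γ₊ with rank_h(vᵢ) ≤ 1 for all i. Then, as polynomials in x, x^{d_μ} · E_{ξ∼μ}[ h(x²e − Σ_{i=1}^n ξᵢvᵢ) ] = x^d · ∏_{i=1}^n (1 − (1/2)∂²_{zᵢ}) [ h(xe + Σ_{i=1}^n zᵢvᵢ) · g_μ(x·𝟏 + z) ]|_{z=0}, where ξ is the indicator vector of the sampled set. Moreover, E_{ξ∼μ}[ h(xe − Σ_{i=1}^n ξᵢvᵢ) ] is real-rooted in x. -/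

import Mathlib

open MvPolynomial Finset
open scoped Classical

noncomputable section

/-- `h` is homogeneous of degree `d`, positive at `e`, and for every `x` the univariate
polynomial `t ↦ h (t • e - x)` factors with real roots `lam x 1 ≥ … ≥ lam x d`
(the hyperbolic eigenvalues of `x`). -/
def IsHyperbolic {m d : ℕ} (h : MvPolynomial (Fin m) ℝ) (e : Fin m → ℝ)
    (lam : (Fin m → ℝ) → Fin d → ℝ) : Prop :=
  h.IsHomogeneous d ∧ 0 < eval e h ∧ (∀ x, Antitone (lam x)) ∧
    ∀ x : Fin m → ℝ, ∀ t : ℝ,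
      eval (t • e - x) h = eval e h * ∏ i, (t - lam x i)

/-- hyperbolic trace: the sum of the hyperbolic eigenvalues. -/
def htrace {m d : ℕ} (lam : (Fin m → ℝ) → Fin d → ℝ) (x : Fin m → ℝ) : ℝ :=
  ∑ i, lam x i

/-- hyperbolic rank: the number of nonzero hyperbolic eigenvalues. -/
def hrank {m d : ℕ} (lam : (Fin m → ℝ) → Fin d → ℝ) (x : Fin m → ℝ) : ℕ :=
  Nat.card {i : Fin d // lam x i ≠ 0}

/-- hyperbolic norm: the largest absolute value of a hyperbolic eigenvalue. -/
def hnorm {m d : ℕ} (lam : (Fin m → ℝ) → Fin d → ℝ) (x : Fin m → ℝ) : ℝ :=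
  ⨆ i, |lam x i|

/-- closed hyperbolicity cone: all hyperbolic eigenvalues nonnegative. -/
def InCone {m d : ℕ} (lam : (Fin m → ℝ) → Fin d → ℝ) (x : Fin m → ℝ) : Prop :=
  ∀ i, 0 ≤ lam x i

/-- open hyperbolicity cone: all hyperbolic eigenvalues positive. -/
def InOpenCone {m d : ℕ} (lam : (Fin m → ℝ) → Fin d → ℝ) (x : Fin m → ℝ) : Prop :=
  ∀ i, 0 < lam x i

/-- A real polynomial is real stable if it has no zero with all coordinates in the
open upper half plane. -/
def RealStable {k : ℕ} (p : MvPolynomial (Fin k) ℝ) : Prop :=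
  ∀ z : Fin k → ℂ, (∀ i, 0 < (z i).im) → (aeval z p : ℂ) ≠ 0

/-- generating polynomial of a distribution on subsets of `[n]`. -/
def genPoly {n : ℕ} (μ : Finset (Fin n) → ℝ) : MvPolynomial (Fin n) ℝ :=
  ∑ S : Finset (Fin n), C (μ S) * ∏ i ∈ S, X i

/-- `μ` is a probability distribution on subsets of `[n]`. -/
def IsProbDist {n : ℕ} (μ : Finset (Fin n) → ℝ) : Prop :=
  (∀ S, 0 ≤ μ S) ∧ ∑ S : Finset (Fin n), μ S = 1

/-- the univariate polynomial `x ↦ h (x • e + u)`. -/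
def uniPoly {m : ℕ} (h : MvPolynomial (Fin m) ℝ) (e u : Fin m → ℝ) : Polynomial ℝ :=
  aeval (fun j : Fin m => Polynomial.C (e j) * Polynomial.X + Polynomial.C (u j)) h

/-- A univariate real polynomial is real-rooted: all complex roots are real. -/
def RealRooted (q : Polynomial ℝ) : Prop :=
  ∀ z : ℂ, Polynomial.aeval z q = 0 → z.im = 0

/-- the `n`-variate polynomial `h (c + ∑ i, z i • v i)` in the variables `z i = X i`. -/
def zPoly {m n : ℕ} (h : MvPolynomial (Fin m) ℝ) (c : Fin m → ℝ)
    (v : Fin n → Fin m → ℝ) : MvPolynomial (Fin n) ℝ :=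
  aeval (fun j : Fin m => C (c j) + ∑ i : Fin n, X i * C (v i j)) h

/-- substitute `z i ↦ x + z i` in a polynomial in the variables `z`. -/
def shiftPoly {n : ℕ} (g : MvPolynomial (Fin n) ℝ) (x : ℝ) : MvPolynomial (Fin n) ℝ :=
  aeval (fun i : Fin n => C x + X i) g

/-- apply the operator `∏ i (1 - (1/2) ∂²_{z i})`. -/
def opHalf {n : ℕ} (P : MvPolynomial (Fin n) ℝ) : MvPolynomial (Fin n) ℝ :=
  (List.finRange n).foldl (fun Q i => Q - C (1 / 2 : ℝ) * pderiv i (pderiv i Q)) P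

/-- The restriction `t ↦ h (a + t v)` of a real polynomial to a complex line. -/
def linePoly {m : ℕ} (h : MvPolynomial (Fin m) ℝ) (a v : Fin m → ℂ) : Polynomial ℂ :=
  aeval (fun j => Polynomial.C (a j) + Polynomial.C (v j) * Polynomial.X) h

lemma eval_linePoly {m : ℕ} (h : MvPolynomial (Fin m) ℝ) (a v : Fin m → ℂ) (t : ℂ) :
    (linePoly h a v).eval t = aeval (a + t • v) h := by
  have := comp_aeval_apply (fun j => Polynomial.C (a j) + Polynomial.C (v j) * Polynomial.X)
    ((Polynomial.aeval (R := ℂ) t).restrictScalars ℝ) h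
  rw [linePoly, ← Polynomial.coe_aeval_eq_eval]
  refine this.trans (congrArg (fun w => aeval w h) (funext fun j => ?_))
  change Polynomial.aeval t (Polynomial.C (a j) + Polynomial.C (v j) * Polynomial.X)
    = a j + t * v j
  rw [mul_comm t]
  simp

lemma natDegree_coeff_prod_linear {ι : Type*} (s : Finset ι) (a v : ι → ℂ) (k : ι → ℕ) :
    (∏ j ∈ s, (Polynomial.C (a j) + Polynomial.C (v j) * Polynomial.X) ^ k j).natDegree
        ≤ ∑ j ∈ s, k j ∧
      (∏ j ∈ s, (Polynomial.C (a j) + Polynomial.C (v j) * Polynomial.X) ^ k j).coeff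
        (∑ j ∈ s, k j) = ∏ j ∈ s, v j ^ k j := by
  have hlin : ∀ j, (Polynomial.C (a j) + Polynomial.C (v j) * Polynomial.X).natDegree ≤ 1 := by
    intro j; compute_degree
  have hpow : ∀ j, ((Polynomial.C (a j) + Polynomial.C (v j) * Polynomial.X) ^ k j).natDegree
      ≤ k j := fun j => by
    simpa using Polynomial.natDegree_pow_le_of_le (k j) (hlin j)
  induction s using Finset.induction_on with
  | empty => simp
  | insert i s hi ih =>
    rw [Finset.prod_insert hi, Finset.sum_insert hi, Finset.prod_insert hi]
    refine ⟨Polynomial.natDegree_mul_le_of_le (hpow i) ih.1, ?_⟩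
    rw [Polynomial.coeff_mul_add_eq_of_natDegree_le (hpow i) ih.1, ih.2]
    have := Polynomial.coeff_pow_of_natDegree_le (m := k i) (hlin i)
    rw [mul_one] at this
    rw [this]
    simp

lemma linePoly_eq_sum {m : ℕ} (h : MvPolynomial (Fin m) ℝ) (a v : Fin m → ℂ) :
    linePoly h a v = ∑ k ∈ h.support, Polynomial.C ((coeff k h : ℝ) : ℂ) *
      ∏ j, (Polynomial.C (a j) + Polynomial.C (v j) * Polynomial.X) ^ k j := by
  rw [linePoly, aeval_def, eval₂_eq']
  rfl

lemma natDegree_linePoly_le {m d : ℕ} {h : MvPolynomial (Fin m) ℝ} (hh : h.IsHomogeneous d)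
    (a v : Fin m → ℂ) : (linePoly h a v).natDegree ≤ d := by
  rw [linePoly_eq_sum]
  refine Polynomial.natDegree_sum_le_of_forall_le _ _ fun k hk => ?_
  refine (Polynomial.natDegree_C_mul_le _ _).trans ?_
  refine (natDegree_coeff_prod_linear _ a v k).1.trans ?_
  have := hh (mem_support_iff.1 hk)
  rw [Finsupp.weight_apply, Finsupp.sum_fintype _ _ (by simp)] at this
  simp at this
  exact this.le

lemma coeff_linePoly {m d : ℕ} {h : MvPolynomial (Fin m) ℝ} (hh : h.IsHomogeneous d)
    (a v : Fin m → ℂ) : (linePoly h a v).coeff d = aeval v h := by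
  rw [linePoly_eq_sum, Polynomial.finsetSum_coeff, aeval_def, eval₂_eq']
  refine Finset.sum_congr rfl fun k hk => ?_
  have := hh (mem_support_iff.1 hk)
  rw [Finsupp.weight_apply, Finsupp.sum_fintype _ _ (by simp)] at this
  simp at this
  rw [Polynomial.coeff_C_mul, ← this, (natDegree_coeff_prod_linear _ a v k).2]
  rfl

lemma aeval_smul_of_isHomogeneous {m d : ℕ} {R : Type*} [CommRing R] [Algebra ℝ R]
    {h : MvPolynomial (Fin m) ℝ} (hh : h.IsHomogeneous d)
    (c : R) (w : Fin m → R) : aeval (c • w) h = c ^ d * aeval w h := by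
  rw [aeval_def, aeval_def, eval₂_eq', eval₂_eq', Finset.mul_sum]
  refine Finset.sum_congr rfl fun k hk => ?_
  have := hh (mem_support_iff.1 hk)
  rw [Finsupp.weight_apply, Finsupp.sum_fintype _ _ (by simp)] at this
  simp at this
  simp only [Pi.smul_apply, smul_eq_mul, mul_pow, Finset.prod_mul_distrib,
    Finset.prod_pow_eq_pow_sum, this]
  ring

lemma norm_eval_eq_prod_roots (p : Polynomial ℂ) (t : ℂ) :
    ‖p.eval t‖ = ‖p.leadingCoeff‖ * (p.roots.map fun r => ‖t - r‖).prod := by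
  rw [(IsAlgClosed.splits p).eval_eq_prod_roots, norm_mul]
  congr 1
  change (normHom : ℂ →*₀ ℝ) _ = _
  rw [map_multiset_prod, Multiset.map_map]
  rfl

/-- If every root of `p` is at distance at least `ρ` from `t`, then `p t` is bounded below. -/
lemma norm_leadingCoeff_mul_pow_le (p : Polynomial ℂ) (t : ℂ) (ρ : ℝ) (hρ : 0 ≤ ρ)
    (H : ∀ r, p.IsRoot r → ρ ≤ ‖t - r‖) :
    ‖p.leadingCoeff‖ * ρ ^ p.natDegree ≤ ‖p.eval t‖ := by
  rw [norm_eval_eq_prod_roots, (IsAlgClosed.splits p).natDegree_eq_card_roots]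
  gcongr
  rw [← Multiset.prod_replicate, ← Multiset.map_const']
  exact Multiset.prod_map_le_prod_map₀ _ _ (fun _ _ => hρ)
    fun r hr => H r (Polynomial.isRoot_of_mem_roots hr)

/-- A polynomial without roots of positive real part is nondecreasing in norm on `[0, ∞)`. -/
lemma norm_eval_zero_le_norm_eval_one (p : Polynomial ℂ) (H : ∀ r, p.IsRoot r → r.re ≤ 0) :
    ‖p.eval 0‖ ≤ ‖p.eval 1‖ := by
  rw [norm_eval_eq_prod_roots, norm_eval_eq_prod_roots]
  gcongr
  refine Multiset.prod_map_le_prod_map₀ _ _ (fun _ _ => norm_nonneg _) fun r hr => ?_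
  have := H r (Polynomial.isRoot_of_mem_roots hr)
  rw [← sq_le_sq₀ (norm_nonneg _) (norm_nonneg _), ← Complex.normSq_eq_norm_sq,
    ← Complex.normSq_eq_norm_sq, Complex.normSq_apply, Complex.normSq_apply]
  simp
  nlinarith

lemma continuous_aeval_complex {m : ℕ} (h : MvPolynomial (Fin m) ℝ) :
    Continuous fun w : Fin m → ℂ => aeval w h := by
  simp only [aeval_def, eval₂_eq_eval_map]
  exact MvPolynomial.continuous_eval _

/-- Roots in `t` of `h (a + θ b + t v)` cannot cross the real axis as `θ` goes from `0` to `1`. -/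
lemma aeval_ne_zero_of_homotopy {m d : ℕ} {h : MvPolynomial (Fin m) ℝ}
    (hh : h.IsHomogeneous d) (a b v : Fin m → ℂ) (hv : aeval v h ≠ 0)
    (hreal : ∀ θ ∈ Set.Icc (0 : ℝ) 1, ∀ t : ℝ, aeval (a + (θ : ℂ) • b + (t : ℂ) • v) h ≠ 0)
    (h0 : ∀ t : ℂ, 0 ≤ t.im → aeval (a + t • v) h ≠ 0) (t : ℂ) (ht : 0 ≤ t.im) :
    aeval (a + b + t • v) h ≠ 0 := by
  have hcont := continuous_aeval_complex h
  let F : ℝ × ℂ → ℂ := fun q => aeval (a + (q.1 : ℂ) • b + q.2 • v) h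
  have hF : Continuous F := hcont.comp (by fun_prop)
  let A : Set ℝ := {θ | ∃ t : ℂ, 0 ≤ t.im ∧ F (θ, t) = 0}
  -- roots are bounded
  obtain ⟨R, hR⟩ : ∃ R : ℝ, ∀ θ ∈ Set.Icc (0 : ℝ) 1, ∀ t : ℂ, F (θ, t) = 0 → ‖t‖ ≤ R := by
    have hev : ∀ᶠ w in nhds v, aeval w h ≠ 0 := hcont.continuousAt.eventually_ne hv
    obtain ⟨δ, hδ, hball⟩ := Metric.eventually_nhds_iff.1 hev
    refine ⟨(‖a‖ + ‖b‖) / δ, fun θ hθ t hzero => ?_⟩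
    by_contra! hlt
    have hab : ‖a + (θ : ℂ) • b‖ ≤ ‖a‖ + ‖b‖ := by
      refine (norm_add_le _ _).trans ?_
      gcongr
      rw [norm_smul]
      refine mul_le_of_le_one_left (norm_nonneg _) ?_
      simp [abs_of_nonneg hθ.1, hθ.2]
    have htpos : 0 < ‖t‖ := lt_of_le_of_lt (by positivity) hlt
    have ht0 : t ≠ 0 := norm_pos_iff.1 htpos
    have hd : dist (t⁻¹ • (a + (θ : ℂ) • b) + v) v < δ := by
      rw [dist_eq_norm, add_sub_cancel_right, norm_smul, norm_inv, inv_mul_lt_iff₀ htpos]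
      rw [div_lt_iff₀ hδ] at hlt
      linarith
    apply hball hd
    have : a + (θ : ℂ) • b + t • v = t • (t⁻¹ • (a + (θ : ℂ) • b) + v) := by
      rw [smul_add, smul_smul, mul_inv_cancel₀ ht0, one_smul]
    simp only [F] at hzero
    rw [this, aeval_smul_of_isHomogeneous hh] at hzero
    exact (mul_eq_zero.1 hzero).resolve_left (pow_ne_zero _ ht0)
  have hclosed : IsClosed (A ∩ Set.Icc 0 1) := by
    have hK : IsCompact ((Set.Icc (0 : ℝ) 1 ×ˢ Metric.closedBall (0 : ℂ) R) ∩
        {q | 0 ≤ q.2.im ∧ F q = 0}) := by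
      refine (isCompact_Icc.prod (isCompact_closedBall _ _)).inter_right ?_
      exact (isClosed_le continuous_const (Complex.continuous_im.comp continuous_snd)).inter
        (isClosed_eq hF continuous_const)
    have hK' : IsClosed (Prod.fst '' _) := (hK.image continuous_fst).isClosed
    convert hK' using 1
    ext θ
    constructor
    · rintro ⟨⟨t, ht, hz⟩, hθ⟩
      exact ⟨(θ, t), ⟨⟨hθ, by simpa using hR θ hθ t hz⟩, ht, hz⟩, rfl⟩
    · rintro ⟨⟨θ', t⟩, ⟨⟨hθ, -⟩, ht, hz⟩, rfl⟩
      exact ⟨⟨t, ht, hz⟩, hθ⟩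
  have hopen : ∀ θ ∈ A ∩ Set.Icc 0 1, ∀ᶠ θ' in nhds θ, θ' ∈ A := by
    rintro θ ⟨⟨t, ht, hz⟩, hθ⟩
    have htpos : 0 < t.im := by
      refine lt_of_le_of_ne ht fun h0 => hreal θ hθ t.re ?_
      have : ((t.re : ℝ) : ℂ) = t := Complex.ext rfl (by simpa using h0)
      rw [this]; exact hz
    have hpos : 0 < ‖aeval v h‖ * t.im ^ d := mul_pos (norm_pos_iff.2 hv) (pow_pos htpos _)
    have hc : ContinuousAt (fun θ' : ℝ => ‖F (θ', t)‖) θ := by fun_prop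
    have hev := hc.eventually_lt (continuousAt_const (y := ‖aeval v h‖ * t.im ^ d))
      (by rw [hz]; simpa using hpos)
    filter_upwards [hev] with θ' hθ'
    by_contra hA
    let p := linePoly h (a + (θ' : ℂ) • b) v
    have hcoeff : p.coeff d = aeval v h := coeff_linePoly hh _ _
    have hdeg : p.natDegree = d := le_antisymm (natDegree_linePoly_le hh _ _)
      (Polynomial.le_natDegree_of_ne_zero (by rw [hcoeff]; exact hv))
    have := norm_leadingCoeff_mul_pow_le p t t.im ht fun r hr => by
      have hneg : r.im < 0 := by
        by_contra! hge
        exact hA ⟨r, hge, by simpa [p, F, eval_linePoly] using hr⟩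
      calc t.im ≤ (t - r).im := by simp; linarith
        _ ≤ ‖t - r‖ := (le_abs_self _).trans (Complex.abs_im_le_norm _)
    rw [Polynomial.leadingCoeff, hdeg, hcoeff, eval_linePoly] at this
    exact absurd hθ' (not_lt.2 this)
  intro hzero
  have h1 : (1 : ℝ) ∈ A := ⟨t, ht, by simpa [F] using hzero⟩
  have hpre : IsPreconnected (Set.Icc (0 : ℝ) 1) := isPreconnected_Icc
  have h0A : (0 : ℝ) ∉ A := by
    rintro ⟨s, hs, hz⟩
    exact h0 s hs (by simpa [F] using hz)
  have hmem : ∀ θ ∈ Set.Icc (0 : ℝ) 1, 1 - θ ∈ A := by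
    have hcl : IsClosed ({θ : ℝ | 1 - θ ∈ A} ∩ Set.Icc 0 1) := by
      convert hclosed.preimage (f := fun θ : ℝ => 1 - θ) (by fun_prop) using 1
      ext θ
      simp only [Set.mem_inter_iff, Set.mem_ofPred_eq, Set.mem_preimage, Set.mem_Icc]
      constructor <;> rintro ⟨h1, h2, h3⟩ <;> exact ⟨h1, by linarith, by linarith⟩
    refine hcl.Icc_subset_of_forall_mem_nhdsWithin (by simpa using h1) ?_
    rintro θ ⟨hθ, hθ'⟩
    have := hopen (1 - θ) ⟨hθ, by linarith [hθ'.2], by linarith [hθ'.1]⟩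
    have hc : ContinuousAt (fun θ : ℝ => 1 - θ) θ := by fun_prop
    exact mem_nhdsWithin_of_mem_nhds (hc.eventually this)
  exact h0A (by simpa using hmem 1 (by simp))

/-- The complexification of a real vector. -/
def cvec {m : ℕ} (x : Fin m → ℝ) : Fin m → ℂ := fun j => (x j : ℂ)

lemma cvec_add {m : ℕ} (x y : Fin m → ℝ) : cvec (x + y) = cvec x + cvec y := by
  ext j; simp [cvec]

lemma cvec_sub {m : ℕ} (x y : Fin m → ℝ) : cvec (x - y) = cvec x - cvec y := by
  ext j; simp [cvec]

lemma cvec_smul {m : ℕ} (c : ℝ) (x : Fin m → ℝ) : cvec (c • x) = (c : ℂ) • cvec x := by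
  ext j; simp [cvec]

lemma cvec_zero {m : ℕ} : cvec (0 : Fin m → ℝ) = 0 := by
  ext j; simp [cvec]

lemma aeval_cvec {m : ℕ} (h : MvPolynomial (Fin m) ℝ) (x : Fin m → ℝ) :
    aeval (cvec x) h = ((eval x h : ℝ) : ℂ) :=
  aeval_algebraMap_apply ℂ x h

lemma IsHyperbolic.aeval_sub {m d : ℕ} {h : MvPolynomial (Fin m) ℝ} {e : Fin m → ℝ}
    {lam : (Fin m → ℝ) → Fin d → ℝ} (hhyp : IsHyperbolic h e lam) (x : Fin m → ℝ) (s : ℂ) :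
    aeval (s • cvec e - cvec x) h = (eval e h : ℝ) * ∏ i, (s - (lam x i : ℂ)) := by
  have hpq : linePoly h (-cvec x) (cvec e) = Polynomial.C ((eval e h : ℝ) : ℂ) *
      ∏ i, (Polynomial.X - Polynomial.C (lam x i : ℂ)) := by
    refine Polynomial.eq_of_infinite_eval_eq _ _
      ((Set.infinite_range_of_injective Complex.ofReal_injective).mono ?_)
    rintro _ ⟨t, rfl⟩
    have := congrArg Complex.ofReal (hhyp.2.2.2 x t)
    rw [← aeval_cvec, cvec_sub, cvec_smul] at this
    simp only [Set.mem_ofPred_eq, eval_linePoly]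
    rw [neg_add_eq_sub, this]
    simp [Polynomial.eval_prod]
  have := congrArg (Polynomial.eval s) hpq
  rw [eval_linePoly, neg_add_eq_sub] at this
  rw [this]
  simp [Polynomial.eval_prod]

/-- `u` is a complex direction all of whose nonnegative multiples may be added to
`x + s e`, with `s` in the open upper half plane, without meeting a zero of `h`. -/
def IsStableDir {m : ℕ} (h : MvPolynomial (Fin m) ℝ) (e : Fin m → ℝ) (u : Fin m → ℂ) : Prop :=
  ∀ θ : ℝ, 0 ≤ θ → ∀ (x : Fin m → ℝ) (s : ℂ), 0 < s.im →
    aeval (cvec x + s • cvec e + (θ : ℂ) • u) h ≠ 0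

section Stability

variable {m d : ℕ} {h : MvPolynomial (Fin m) ℝ} {e : Fin m → ℝ} {lam : (Fin m → ℝ) → Fin d → ℝ}

lemma IsHyperbolic.aeval_ne_zero (hhyp : IsHyperbolic h e lam) (x : Fin m → ℝ) {s : ℂ}
    (hs : 0 < s.im) : aeval (cvec x + s • cvec e) h ≠ 0 := by
  have : cvec x + s • cvec e = s • cvec e - cvec (-x) := by
    ext j; simp [cvec]; ring
  rw [this, hhyp.aeval_sub]
  refine mul_ne_zero (by exact_mod_cast hhyp.2.1.ne') (Finset.prod_ne_zero_iff.2 fun i _ h0 => ?_)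
  have := congrArg Complex.im h0
  simp at this
  exact hs.ne' this

lemma IsHyperbolic.isStableDir_zero (hhyp : IsHyperbolic h e lam) : IsStableDir h e 0 := by
  intro θ _ x s hs
  simpa using hhyp.aeval_ne_zero x hs

lemma IsHyperbolic.aeval_smul_add_smul_ne_zero (hhyp : IsHyperbolic h e lam) {v : Fin m → ℝ}
    (hv : InCone lam v) {s t : ℂ} (hs : 0 < s.im) (ht : 0 ≤ t.im) :
    aeval (s • cvec e + t • cvec v) h ≠ 0 := by
  rcases eq_or_ne t 0 with rfl | ht0
  · simpa [cvec_zero] using hhyp.aeval_ne_zero 0 hs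
  have : s • cvec e + t • cvec v = (-t) • ((-(s / t)) • cvec e - cvec v) := by
    ext j; simp; field_simp; ring
  rw [this, aeval_smul_of_isHomogeneous hhyp.1, hhyp.aeval_sub]
  refine mul_ne_zero (pow_ne_zero _ (neg_ne_zero.2 ht0)) (mul_ne_zero
    (by exact_mod_cast hhyp.2.1.ne') (Finset.prod_ne_zero_iff.2 fun i _ h0 => ?_))
  have hst : s = -(t * (lam v i : ℂ)) := by
    field_simp at h0
    linear_combination -h0
  have := congrArg Complex.im hst
  simp at this
  have := mul_nonneg ht (hv i)
  linarith

lemma IsHyperbolic.eval_add_smul_pos (hhyp : IsHyperbolic h e lam) {v : Fin m → ℝ}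
    (hv : InCone lam v) {ε : ℝ} (hε : 0 < ε) : aeval (cvec v + (ε : ℂ) • cvec e) h ≠ 0 := by
  have := hhyp.aeval_smul_add_smul_ne_zero hv (s := Complex.I * ε) (t := Complex.I)
    (by simpa) (by simp)
  rw [mul_smul, ← smul_add, aeval_smul_of_isHomogeneous hhyp.1, add_comm] at this
  exact right_ne_zero_of_mul this

lemma IsStableDir.smul {u : Fin m → ℂ} (hu : IsStableDir h e u) {c : ℝ} (hc : 0 ≤ c) :
    IsStableDir h e ((c : ℂ) • u) := by
  intro θ hθ x s hs
  have := hu (θ * c) (mul_nonneg hθ hc) x s hs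
  rwa [Complex.ofReal_mul, mul_smul] at this

lemma IsStableDir.add_smul (hhyp : IsHyperbolic h e lam) {u : Fin m → ℂ}
    (hu : IsStableDir h e u) {v : Fin m → ℝ} (hv : InCone lam v) {t : ℂ} (ht : 0 ≤ t.im) :
    IsStableDir h e (u + t • cvec v) := by
  have key : ∀ u' : Fin m → ℂ, IsStableDir h e u' → ∀ (x : Fin m → ℝ) (s t : ℂ), 0 < s.im →
      0 ≤ t.im → aeval (cvec x + s • cvec e + (u' + t • cvec v)) h ≠ 0 := by
    intro u' hu' x s t hs ht
    obtain ⟨ε, hε, hεt⟩ : ∃ ε : ℝ, 0 < ε ∧ 0 < s.im - ε * t.im := by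
      refine ⟨s.im / (2 * (t.im + 1)), by positivity, ?_⟩
      have : s.im / (2 * (t.im + 1)) * t.im < s.im := by
        rw [div_mul_eq_mul_div, div_lt_iff₀ (by positivity)]
        nlinarith
      linarith
    have hs' : 0 < (s - ε * t).im := by simpa using hεt
    have := aeval_ne_zero_of_homotopy hhyp.1 ((s - ε * t) • cvec e) (cvec x + u')
      (cvec v + (ε : ℂ) • cvec e) (hhyp.eval_add_smul_pos hv hε) ?_ ?_ t ht
    · convert this using 2
      ext j; simp; ring_nf
    · intro θ hθ r
      have := hu' θ hθ.1 (θ • x + r • (v + ε • e)) _ hs'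
      convert this using 2
      ext j; simp [cvec]; ring_nf
    · intro r hr
      have := hhyp.aeval_smul_add_smul_ne_zero hv (s := s - ε * t + ε * r) (t := r)
        (by simp at hs' ⊢; nlinarith [mul_nonneg hε.le hr]) hr
      convert this using 2
      ext j; simp; ring_nf
  intro θ hθ x s hs
  have := key _ (hu.smul hθ) x s (θ * t) hs (by simpa using mul_nonneg hθ ht)
  rwa [mul_smul, ← smul_add] at this

/-- Stability: `h` does not vanish on `x + s e + ∑ zᵢ vᵢ` for `x` real, `s` in the open and `zᵢ`
in the closed upper half plane, and `vᵢ` in the cone. -/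
lemma IsHyperbolic.stable (hhyp : IsHyperbolic h e lam) {ι : Type*} (S : Finset ι)
    {v : ι → Fin m → ℝ} (hv : ∀ i, InCone lam (v i)) {z : ι → ℂ} (hz : ∀ i, 0 ≤ (z i).im)
    (x : Fin m → ℝ) {s : ℂ} (hs : 0 < s.im) :
    aeval (cvec x + s • cvec e + ∑ i ∈ S, z i • cvec (v i)) h ≠ 0 := by
  have : IsStableDir h e (∑ i ∈ S, z i • cvec (v i)) := by
    induction S using Finset.induction_on with
    | empty => simpa using hhyp.isStableDir_zero
    | insert i S hi ih =>
      rw [Finset.sum_insert hi, add_comm]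
      exact ih.add_smul hhyp (hv i) (hz i)
  simpa using this 1 zero_le_one x s hs

/-- `h` is monotone (in absolute value) along the cone. -/
lemma IsHyperbolic.norm_le (hhyp : IsHyperbolic h e lam) {u v w : Fin m → ℝ}
    (hu : InCone lam u) (hv : InCone lam v) (hw : InCone lam w) {δ t : ℝ} (hδ : 0 < δ)
    (ht : 0 ≤ t) :
    |eval (δ • e + u + t • v) h| ≤ |eval (δ • e + u + t • v + w) h| := by
  have := norm_eval_zero_le_norm_eval_one
    (linePoly h (cvec (δ • e + u + t • v)) (cvec w)) fun r hr => ?_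
  · rw [eval_linePoly, eval_linePoly, zero_smul, one_smul, add_zero, ← cvec_add, aeval_cvec,
      aeval_cvec, Complex.norm_real, Complex.norm_real] at this
    exact this
  · by_contra! hre
    rw [Polynomial.IsRoot, eval_linePoly] at hr
    have h1 : IsStableDir h e (0 + Complex.I • cvec u) :=
      hhyp.isStableDir_zero.add_smul hhyp hu (by simp)
    have h2 := h1.add_smul hhyp hv (t := Complex.I * t) (by simpa)
    have h3 := h2.add_smul hhyp hw (t := Complex.I * r) (by simpa using hre.le)
    have h4 := h3 1 zero_le_one 0 (Complex.I * δ) (by simpa)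
    have : cvec 0 + (Complex.I * δ) • cvec e + ((1 : ℝ) : ℂ) • (0 + Complex.I • cvec u
        + (Complex.I * t) • cvec v + (Complex.I * r) • cvec w)
        = Complex.I • (cvec (δ • e + u + t • v) + r • cvec w) := by
      ext j; simp [cvec]; ring
    rw [this, aeval_smul_of_isHomogeneous hhyp.1, hr, mul_zero] at h4
    exact h4 rfl

end Stability

lemma aeval_uniPoly {m : ℕ} {R : Type*} [CommRing R] [Algebra ℝ R]
    (h : MvPolynomial (Fin m) ℝ) (e u : Fin m → ℝ) (t : R) :
    Polynomial.aeval t (uniPoly h e u) =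
      aeval (fun j => algebraMap ℝ R (e j) * t + algebraMap ℝ R (u j)) h := by
  rw [uniPoly, comp_aeval_apply]
  simp

lemma eval_uniPoly {m : ℕ} (h : MvPolynomial (Fin m) ℝ) (e u : Fin m → ℝ) (t : ℝ) :
    (uniPoly h e u).eval t = eval (t • e + u) h := by
  rw [← Polynomial.coe_aeval_eq_eval, aeval_uniPoly, ← aeval_eq_eval]
  refine congrArg (fun w => aeval w h) (funext fun j => ?_)
  simp [mul_comm]

lemma natDegree_le_one_of_abs_le (p : Polynomial ℝ) (A B : ℝ)
    (hp : ∀ t, 0 ≤ t → |p.eval t| ≤ A + B * t) : p.natDegree ≤ 1 := by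
  by_contra! hlt
  let Q : Polynomial ℝ := Polynomial.C (|B| + 1) * Polynomial.X + Polynomial.C (|A| + 1)
  have hB : |B| + 1 ≠ 0 := by positivity
  have hQ : Q.degree = 1 := Polynomial.degree_linear hB
  have hdeg : Q.degree < p.degree :=
    Polynomial.degree_lt_degree (by rwa [Polynomial.natDegree_eq_of_degree_eq_some hQ])
  have := Polynomial.abs_div_tendsto_atTop_atTop_of_degree_gt p Q hdeg
    (by rintro h0; simp [h0] at hQ)
  obtain ⟨t, ht0, ht⟩ := ((Filter.eventually_ge_atTop (0 : ℝ)).and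
    (this.eventually_gt_atTop 1)).exists
  have hQt : Q.eval t = (|B| + 1) * t + (|A| + 1) := by simp [Q]
  have hpos : 0 < Q.eval t := by rw [hQt]; positivity
  rw [abs_div, abs_of_pos hpos, lt_div_iff₀ hpos, one_mul, hQt] at ht
  have := hp t ht0
  nlinarith [le_abs_self A, le_abs_self B, mul_nonneg (sub_nonneg.2 (le_abs_self B)) ht0]

section MultiAffine

variable {m d : ℕ} {h : MvPolynomial (Fin m) ℝ} {e : Fin m → ℝ} {lam : (Fin m → ℝ) → Fin d → ℝ}

lemma IsHyperbolic.inCone_of_forall_ne_zero (hhyp : IsHyperbolic h e lam) {u : Fin m → ℝ}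
    (hu : ∀ s : ℝ, 0 < s → eval (s • e + u) h ≠ 0) : InCone lam u := by
  intro i
  by_contra! hneg
  refine hu (-lam u i) (by linarith) ?_
  have h1 : eval (lam u i • e - u) h = 0 := by
    rw [hhyp.2.2.2, Finset.prod_eq_zero (Finset.mem_univ i) (sub_self _), mul_zero]
  have h2 : (-lam u i) • e + u = (-1 : ℝ) • (lam u i • e - u) := by
    ext j; simp; ring
  have h3 := aeval_smul_of_isHomogeneous hhyp.1 (-1 : ℝ) (lam u i • e - u)
  rw [aeval_eq_eval, aeval_eq_eval, h1, mul_zero] at h3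
  rw [h2, h3]

lemma IsHyperbolic.inCone_smul_add (hhyp : IsHyperbolic h e lam) (x : Fin m → ℝ) {c : ℝ}
    (hc : ∑ i, |lam (-x) i| ≤ c) : InCone lam (c • e + x) := by
  refine hhyp.inCone_of_forall_ne_zero fun s hs => ?_
  have : s • e + (c • e + x) = (s + c) • e - (-x) := by
    ext j; simp; ring
  rw [this, hhyp.2.2.2]
  refine mul_ne_zero hhyp.2.1.ne' (Finset.prod_ne_zero_iff.2 fun i _ => ne_of_gt ?_)
  have h1 := Finset.single_le_sum (f := fun i => |lam (-x) i|) (fun _ _ => abs_nonneg _)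
    (Finset.mem_univ i)
  have h2 := le_abs_self (lam (-x) i)
  linarith

lemma IsHyperbolic.eval_smul_add_smul (hhyp : IsHyperbolic h e lam) (v : Fin m → ℝ) (c t : ℝ) :
    eval (c • e + t • v) h = eval e h * ∏ i, (c + t * lam v i) := by
  rcases eq_or_ne t 0 with rfl | ht
  · have := aeval_smul_of_isHomogeneous hhyp.1 c e
    rw [aeval_eq_eval, aeval_eq_eval] at this
    simp [this, mul_comm]
  have h1 : c • e + t • v = (-t) • ((-(c / t)) • e - v) := by
    ext j; simp; field_simp; ring
  have h2 := aeval_smul_of_isHomogeneous hhyp.1 (-t) ((-(c / t)) • e - v)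
  rw [aeval_eq_eval, aeval_eq_eval, hhyp.2.2.2] at h2
  have h3 : ∏ i, (c + t * lam v i) = ∏ i, ((-t) * (-(c / t) - lam v i)) :=
    Finset.prod_congr rfl fun i _ => by field_simp; ring
  rw [h1, h2, h3, Finset.prod_mul_distrib]
  simp
  ring

lemma abs_prod_le_of_card_le_one {c : ℝ} {l : Fin d → ℝ}
    (hl : Nat.card {i : Fin d // l i ≠ 0} ≤ 1) :
    ∃ A B : ℝ, ∀ t, 0 ≤ t → |∏ i, (c + t * l i)| ≤ A + B * t := by
  by_cases hz : ∀ i, l i = 0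
  · exact ⟨|c| ^ d, 0, fun t _ => by simp [hz]⟩
  push Not at hz
  obtain ⟨i, hi⟩ := hz
  have hsub : Subsingleton {i : Fin d // l i ≠ 0} := by
    rw [← Finite.card_le_one_iff_subsingleton]; exact hl
  have hrest : ∀ j ∈ Finset.univ.erase i, l j = 0 := by
    intro j hj
    by_contra hne
    exact Finset.ne_of_mem_erase hj (congrArg Subtype.val (hsub.elim ⟨j, hne⟩ ⟨i, hi⟩))
  refine ⟨|c| * |c| ^ (d - 1), |l i| * |c| ^ (d - 1), fun t ht => ?_⟩
  rw [← Finset.mul_prod_erase _ _ (Finset.mem_univ i),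
    Finset.prod_congr rfl fun j hj => by rw [hrest j hj, mul_zero, add_zero], Finset.prod_const,
    Finset.card_erase_of_mem (Finset.mem_univ i), Finset.card_univ, Fintype.card_fin, abs_mul,
    abs_pow]
  calc |c + t * l i| * |c| ^ (d - 1) ≤ (|c| + t * |l i|) * |c| ^ (d - 1) := by
        gcongr
        refine (abs_add_le _ _).trans ?_
        rw [abs_mul, abs_of_nonneg ht]
    _ = _ := by ring

lemma IsHyperbolic.exists_abs_eval_le (hhyp : IsHyperbolic h e lam) {u v : Fin m → ℝ}
    (hu : InCone lam u) (hv : InCone lam v) (hvr : hrank lam v ≤ 1) {δ : ℝ} (hδ : 0 < δ) :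
    ∃ A B : ℝ, ∀ t, 0 ≤ t → |eval (δ • e + u + t • v) h| ≤ A + B * t := by
  let c := ∑ i, |lam (-(-u)) i|
  have hw : InCone lam (c • e + -u) := hhyp.inCone_smul_add (-u) le_rfl
  obtain ⟨A, B, hAB⟩ := abs_prod_le_of_card_le_one (c := δ + c) hvr
  refine ⟨eval e h * A, eval e h * B, fun t ht => ?_⟩
  refine (hhyp.norm_le hu hv hw hδ ht).trans ?_
  have : δ • e + u + t • v + (c • e + -u) = (δ + c) • e + t • v := by
    ext j; simp; ring
  rw [this, hhyp.eval_smul_add_smul, abs_mul, abs_of_pos hhyp.2.1]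
  calc _ ≤ eval e h * (A + B * t) := by gcongr; exacts [hhyp.2.1.le, hAB t ht]
    _ = _ := by ring

/-- Along a direction of the cone of rank at most one, `h` is affine. -/
lemma IsHyperbolic.exists_affine (hhyp : IsHyperbolic h e lam) {v : Fin m → ℝ}
    (hv : InCone lam v) (hvr : hrank lam v ≤ 1) :
    ∃ A B : MvPolynomial (Fin m) ℝ, ∀ (R : Type) [CommRing R] [Algebra ℝ R] (y : Fin m → R)
      (t : R), aeval (fun j => y j + t * algebraMap ℝ R (v j)) h
        = aeval y A + t * aeval y B := by
  let H : Polynomial (MvPolynomial (Fin m) ℝ) :=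
    aeval (fun j => Polynomial.C (X j) + Polynomial.X * Polynomial.C (C (v j))) h
  have hH : ∀ (R : Type) [CommRing R] [Algebra ℝ R] (y : Fin m → R) (t : R),
      aeval (fun j => y j + t * algebraMap ℝ R (v j)) h =
        Polynomial.eval₂ (aeval y : MvPolynomial (Fin m) ℝ →ₐ[ℝ] R).toRingHom t H := by
    intro R _ _ y t
    have := comp_aeval_apply
      (fun j => Polynomial.C (X j) + Polynomial.X * Polynomial.C (C (v j)))
      (Polynomial.eval₂AlgHom (aeval y : MvPolynomial (Fin m) ℝ →ₐ[ℝ] R) t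
        (fun _ => Commute.all _ _)) h
    refine Eq.trans ?_ this.symm
    refine congrArg (fun w => aeval w h) (funext fun j => ?_)
    simpa using mul_comm _ _
  have hdeg : H.natDegree ≤ 1 := by
    rw [Polynomial.natDegree_le_iff_coeff_eq_zero]
    intro k hk
    have hgood : ∀ u, InCone lam u → ∀ δ : ℝ, 0 < δ → eval (δ • e + u) (H.coeff k) = 0 := by
      intro u hu δ hδ
      obtain ⟨A, B, hAB⟩ := hhyp.exists_abs_eval_le hu hv hvr hδ
      have hle := natDegree_le_one_of_abs_le (H.map (eval (δ • e + u))) A B fun t ht => by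
        rw [Polynomial.eval_map]
        have h1 := hH ℝ (δ • e + u) t
        refine le_of_eq_of_le (congrArg abs h1.symm) (le_of_eq_of_le ?_ (hAB t ht))
        refine congrArg (fun w => |eval w h|) (funext fun j => ?_)
        simp
      have := Polynomial.coeff_eq_zero_of_natDegree_lt (hle.trans_lt hk)
      rwa [Polynomial.coeff_map] at this
    refine MvPolynomial.funext fun x => ?_
    have hq : uniPoly (H.coeff k) e x = 0 := by
      refine Polynomial.eq_zero_of_infinite_isRoot _
        ((Set.Ici_infinite (∑ i, |lam (-x) i| + 1)).mono fun c hc => ?_)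
      have h1 := hgood _ (hhyp.inCone_smul_add x (c := c - 1)
        (by have := Set.mem_Ici.1 hc; linarith)) 1 one_pos
      rw [Set.mem_ofPred_eq, Polynomial.IsRoot, eval_uniPoly, ← h1]
      congr 2
      ext j; simp; ring
    have h0 := eval_uniPoly (H.coeff k) e x 0
    rw [hq] at h0
    simpa using h0.symm
  obtain ⟨B, A, hAB⟩ := Polynomial.exists_eq_X_add_C_of_natDegree_le_one hdeg
  refine ⟨A, B, fun R _ _ y t => ?_⟩
  rw [hH, hAB]
  simp
  ring

end MultiAffine

/-- The product `∏ⱼ fⱼ(zⱼ)` of univariate polynomials in separate variables. -/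
def prodX {n : ℕ} (f : Fin n → Polynomial ℝ) : MvPolynomial (Fin n) ℝ :=
  ∏ j, Polynomial.aeval (X j) (f j)

/-- The univariate operator `1 - (1/2) ∂²`. -/
def halfOp (q : Polynomial ℝ) : Polynomial ℝ :=
  q - Polynomial.C (1 / 2) * Polynomial.derivative (Polynomial.derivative q)

lemma prodX_eq_mul_erase {n : ℕ} (f : Fin n → Polynomial ℝ) (i : Fin n) :
    prodX f = Polynomial.aeval (X i) (f i) *
      ∏ j ∈ Finset.univ.erase i, Polynomial.aeval (X j : MvPolynomial (Fin n) ℝ) (f j) :=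
  (Finset.mul_prod_erase _ _ (Finset.mem_univ i)).symm

lemma prodX_update {n : ℕ} (f : Fin n → Polynomial ℝ) (i : Fin n) (q : Polynomial ℝ) :
    prodX (Function.update f i q) = Polynomial.aeval (X i) q *
      ∏ j ∈ Finset.univ.erase i, Polynomial.aeval (X j : MvPolynomial (Fin n) ℝ) (f j) := by
  rw [prodX_eq_mul_erase _ i, Function.update_self]
  congr 1
  refine Finset.prod_congr rfl fun j hj => ?_
  rw [Function.update_of_ne (Finset.ne_of_mem_erase hj)]

lemma pderiv_prod_of_notMem {n : ℕ} (f : Fin n → Polynomial ℝ) (i : Fin n)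
    (s : Finset (Fin n)) (hi : i ∉ s) :
    pderiv i (∏ j ∈ s, Polynomial.aeval (X j : MvPolynomial (Fin n) ℝ) (f j)) = 0 := by
  induction s using Finset.induction_on with
  | empty => simp
  | insert k s hk ih =>
    rw [Finset.mem_insert, not_or] at hi
    rw [Finset.prod_insert hk, Derivation.leibniz, ih hi.2, Derivation.map_aeval,
      pderiv_X_of_ne (Ne.symm hi.1)]
    simp

lemma pderiv_prodX {n : ℕ} (f : Fin n → Polynomial ℝ) (i : Fin n) :
    pderiv i (prodX f) = prodX (Function.update f i (Polynomial.derivative (f i))) := by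
  rw [prodX_update, prodX_eq_mul_erase f i, Derivation.leibniz,
    pderiv_prod_of_notMem f i _ (Finset.notMem_erase _ _), Derivation.map_aeval, pderiv_X_self]
  simp [mul_comm]

lemma halfOp_prodX {n : ℕ} (f : Fin n → Polynomial ℝ) (i : Fin n) :
    prodX f - C (1 / 2 : ℝ) * pderiv i (pderiv i (prodX f)) =
      prodX (Function.update f i (halfOp (f i))) := by
  rw [pderiv_prodX, pderiv_prodX, Function.update_idem, Function.update_self, prodX_update,
    prodX_update, prodX_eq_mul_erase f i, halfOp, map_sub, map_mul, Polynomial.aeval_C,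
    algebraMap_eq]
  ring

lemma foldl_prodX {n : ℕ} (l : List (Fin n)) (hl : l.Nodup) (f : Fin n → Polynomial ℝ) :
    l.foldl (fun Q i => Q - C (1 / 2 : ℝ) * pderiv i (pderiv i Q)) (prodX f) =
      prodX fun j => if j ∈ l then halfOp (f j) else f j := by
  induction l generalizing f with
  | nil => simp
  | cons i l ih =>
    rw [List.nodup_cons] at hl
    rw [List.foldl_cons, halfOp_prodX, ih hl.2]
    congr 1
    ext1 j
    rcases eq_or_ne j i with rfl | hj
    · simp [hl.1]
    · simp [hj]

lemma eval_opHalf_prodX {n : ℕ} (f : Fin n → Polynomial ℝ) :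
    eval (0 : Fin n → ℝ) (opHalf (prodX f)) = ∏ j, (halfOp (f j)).eval 0 := by
  rw [opHalf, foldl_prodX _ (List.nodup_finRange n), prodX, map_prod]
  refine Finset.prod_congr rfl fun j _ => ?_
  rw [if_pos (List.mem_finRange j), ← aeval_eq_eval, ← Polynomial.aeval_algHom_apply]
  simp

lemma exists_linearMap_opHalf (n : ℕ) :
    ∃ L : MvPolynomial (Fin n) ℝ →ₗ[ℝ] ℝ, ∀ P, eval (0 : Fin n → ℝ) (opHalf P) = L P := by
  have key : ∀ l : List (Fin n), ∃ L : MvPolynomial (Fin n) ℝ →ₗ[ℝ] MvPolynomial (Fin n) ℝ,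
      ∀ P, l.foldl (fun Q i => Q - C (1 / 2 : ℝ) * pderiv i (pderiv i Q)) P = L P := by
    intro l
    induction l with
    | nil => exact ⟨LinearMap.id, fun P => rfl⟩
    | cons i l ih =>
      obtain ⟨L, hL⟩ := ih
      refine ⟨L ∘ₗ (LinearMap.id - (1 / 2 : ℝ) • ((pderiv i).toLinearMap ∘ₗ
        (pderiv i).toLinearMap)), fun P => ?_⟩
      rw [List.foldl_cons, hL, ← smul_eq_C_mul]
      rfl
  obtain ⟨L, hL⟩ := key (List.finRange n)
  exact ⟨(aeval (0 : Fin n → ℝ)).toLinearMap ∘ₗ L, fun P => by rw [opHalf, hL]; rfl⟩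

lemma eval_opHalf_monomial_mul {n : ℕ} (k : Fin n → ℕ) (hk : ∀ j, k j ≤ 1)
    (T : Finset (Fin n)) (x : ℝ) :
    eval (0 : Fin n → ℝ) (opHalf ((∏ j, X j ^ k j) * ∏ i ∈ T, (C x + X i))) =
      ∏ j, if j ∈ T then (if k j = 0 then x else -1) else (if k j = 0 then 1 else 0) := by
  have : (∏ j, X j ^ k j) * ∏ i ∈ T, (C x + X i) = prodX fun j : Fin n =>
      Polynomial.X ^ k j * if j ∈ T then Polynomial.C x + Polynomial.X else 1 := by
    simp only [prodX, map_mul, Finset.prod_mul_distrib, map_pow, Polynomial.aeval_X]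
    congr 1
    simp only [apply_ite (Polynomial.aeval _), map_add, map_one, Polynomial.aeval_X,
      Polynomial.aeval_C, algebraMap_eq]
    rw [Finset.prod_ite_mem, Finset.univ_inter]
  rw [this, eval_opHalf_prodX]
  refine Finset.prod_congr rfl fun j _ => ?_
  have h01 : k j = 0 ∨ k j = 1 := by have := hk j; omega
  rcases h01 with h | h <;> by_cases hT : j ∈ T <;> 
    simp [h, hT, halfOp, mul_add]
  norm_num

lemma eval_opHalf_mul_prod {n : ℕ} (P : MvPolynomial (Fin n) ℝ) (hP : ∀ i, P.degreeOf i ≤ 1)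
    (T : Finset (Fin n)) {x : ℝ} (hx : x ≠ 0) :
    eval (0 : Fin n → ℝ) (opHalf (P * ∏ i ∈ T, (C x + X i))) =
      x ^ T.card * eval (fun i => if i ∈ T then -x⁻¹ else 0) P := by
  obtain ⟨L, hL⟩ := exists_linearMap_opHalf n
  rw [hL, eval_eq']
  conv_lhs => rw [P.as_sum, Finset.sum_mul, map_sum]
  rw [Finset.mul_sum]
  refine Finset.sum_congr rfl fun k hk => ?_
  have hk1 : ∀ j, k j ≤ 1 := fun j => (degreeOf_le_iff.1 (hP j)) k hk
  rw [monomial_eq, mul_assoc, ← smul_eq_C_mul, map_smul, ← hL, Finsupp.prod_fintype _ _ (by simp),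
    eval_opHalf_monomial_mul k hk1, smul_eq_mul]
  have : x ^ T.card = ∏ j, if j ∈ T then x else 1 := by simp
  rw [this, mul_left_comm, ← Finset.prod_mul_distrib]
  congr 1
  refine Finset.prod_congr rfl fun j _ => ?_
  have h01 : k j = 0 ∨ k j = 1 := by have := hk1 j; omega
  rcases h01 with h | h <;> by_cases hT : j ∈ T <;> simp [h, hT, hx]

lemma eval_zPoly {m n : ℕ} (h : MvPolynomial (Fin m) ℝ) (c : Fin m → ℝ)
    (v : Fin n → Fin m → ℝ) (z : Fin n → ℝ) :
    eval z (zPoly h c v) = eval (c + ∑ i, z i • v i) h := by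
  rw [zPoly, ← aeval_eq_eval, comp_aeval_apply, ← aeval_eq_eval]
  refine congrArg (fun w => aeval w h) (funext fun j => ?_)
  simp

lemma shiftPoly_genPoly {n : ℕ} (μ : Finset (Fin n) → ℝ) (x : ℝ) :
    shiftPoly (genPoly μ) x = ∑ T, C (μ T) * ∏ i ∈ T, (C x + X i) := by
  simp [shiftPoly, genPoly]

lemma card_eq_of_isHomogeneous_genPoly {n : ℕ} {μ : Finset (Fin n) → ℝ} {dμ : ℕ}
    (hhom : (genPoly μ).IsHomogeneous dμ) {T : Finset (Fin n)} (hT : μ T ≠ 0) :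
    T.card = dμ := by
  have happ : ∀ (S : Finset (Fin n)) (j : Fin n),
      (∑ i ∈ S, Finsupp.single i 1 : Fin n →₀ ℕ) j = if j ∈ S then 1 else 0 := by
    intro S j
    simp [Finsupp.finsetSum_apply, Finsupp.single_apply]
  have hinj : ∀ S : Finset (Fin n),
      (∑ i ∈ S, Finsupp.single i 1 : Fin n →₀ ℕ) = ∑ i ∈ T, Finsupp.single i 1 ↔ S = T := by
    refine fun S => ⟨fun hST => ?_, fun hST => by rw [hST]⟩
    ext j
    have := DFunLike.congr_fun hST j
    rw [happ, happ] at this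
    by_cases h1 : j ∈ S <;> by_cases h2 : j ∈ T <;> simp_all
  have hcoeff : coeff (∑ i ∈ T, Finsupp.single i 1) (genPoly μ) = μ T := by
    have hX : ∀ S : Finset (Fin n), (∏ i ∈ S, X i : MvPolynomial (Fin n) ℝ) =
        monomial (∑ i ∈ S, Finsupp.single i 1) 1 := fun S => by
      rw [monomial_sum_one]; rfl
    simp [genPoly, coeff_sum, hX, coeff_monomial, hinj]
  have := hhom (by rwa [hcoeff])
  rw [Finsupp.weight_apply, Finsupp.sum_fintype _ _ (by simp)] at this
  simpa [happ] using this

section Identity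

variable {m d n : ℕ} {h : MvPolynomial (Fin m) ℝ} {e : Fin m → ℝ}
  {lam : (Fin m → ℝ) → Fin d → ℝ}

lemma IsHyperbolic.degreeOf_zPoly_le (hhyp : IsHyperbolic h e lam) {v : Fin n → Fin m → ℝ}
    (hv : ∀ i, InCone lam (v i)) (hvrank : ∀ i, hrank lam (v i) ≤ 1) (c : Fin m → ℝ)
    (i : Fin n) : (zPoly h c v).degreeOf i ≤ 1 := by
  obtain ⟨A, B, hAB⟩ := hhyp.exists_affine (hv i) (hvrank i)
  let y : Fin m → MvPolynomial (Fin n) ℝ :=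
    fun j => C (c j) + ∑ l ∈ Finset.univ.erase i, X l * C (v l j)
  have hz : zPoly h c v = aeval y A + X i * aeval y B := by
    rw [← hAB, zPoly]
    refine congrArg (fun w => aeval w h) (funext fun j => ?_)
    simp only [y, algebraMap_eq]
    rw [← Finset.add_sum_erase _ _ (Finset.mem_univ i)]
    ring
  have hy : ∀ p : MvPolynomial (Fin m) ℝ, (aeval y p).degreeOf i = 0 := by
    intro p
    have hmem : aeval y p ∈ supported ℝ ({i}ᶜ : Set (Fin n)) := by
      have hyj : ∀ j, y j ∈ supported ℝ ({i}ᶜ : Set (Fin n)) := fun j =>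
        add_mem (Subalgebra.algebraMap_mem _ _) (sum_mem fun l hl =>
          mul_mem (X_mem_supported.2 (Finset.ne_of_mem_erase hl))
            (Subalgebra.algebraMap_mem _ _))
      rw [aeval_def, eval₂_eq']
      exact sum_mem fun k _ => mul_mem (Subalgebra.algebraMap_mem _ _)
        (prod_mem fun j _ => pow_mem (hyj j) _)
    by_contra hne
    exact mem_supported.1 hmem (mem_vars_iff_degreeOf_ne_zero.2 hne) rfl
  rw [hz]
  refine (degreeOf_add_le _ _ _).trans (max_le ((hy A).le.trans zero_le_one) ?_)
  refine (degreeOf_mul_le _ _ _).trans ?_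
  rw [hy, degreeOf_X]
  simp

theorem mixed_characteristic_identity (hhyp : IsHyperbolic h e lam)
    (μ : Finset (Fin n) → ℝ) (dμ : ℕ) (hhom : (genPoly μ).IsHomogeneous dμ)
    (v : Fin n → Fin m → ℝ) (hv : ∀ i, InCone lam (v i))
    (hvrank : ∀ i, hrank lam (v i) ≤ 1) (x : ℝ) :
    x ^ dμ * ∑ T : Finset (Fin n), μ T * eval ((x ^ 2) • e - ∑ i ∈ T, v i) h
      = x ^ d * eval (0 : Fin n → ℝ)
          (opHalf (zPoly h (x • e) v * shiftPoly (genPoly μ) x)) := by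
  obtain ⟨L, hL⟩ := exists_linearMap_opHalf n
  have hexp : eval (0 : Fin n → ℝ) (opHalf (zPoly h (x • e) v * shiftPoly (genPoly μ) x)) =
      ∑ T, μ T * eval (0 : Fin n → ℝ)
        (opHalf (zPoly h (x • e) v * ∏ i ∈ T, (C x + X i))) := by
    simp only [hL]
    rw [shiftPoly_genPoly, Finset.mul_sum, map_sum]
    refine Finset.sum_congr rfl fun T _ => ?_
    rw [mul_left_comm, ← smul_eq_C_mul, map_smul, smul_eq_mul]
  rw [hexp, Finset.mul_sum, Finset.mul_sum]
  refine Finset.sum_congr rfl fun T _ => ?_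
  rcases eq_or_ne (μ T) 0 with h0 | h0
  · simp [h0]
  have hcard := card_eq_of_isHomogeneous_genPoly hhom h0
  have hscale : ∀ c : ℝ, ∀ w : Fin m → ℝ, eval (c • w) h = c ^ d * eval w h := fun c w => by
    simpa [aeval_eq_eval] using aeval_smul_of_isHomogeneous hhyp.1 c w
  rcases Nat.eq_zero_or_pos d with rfl | hd
  · have hC : h = C (coeff 0 h) := by
      rw [← totalDegree_eq_zero_iff_eq_C]
      exact Nat.le_zero.1 hhyp.1.totalDegree_le
    have h1 := eval_opHalf_monomial_mul (n := n) (fun _ => 0) (by simp) T x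
    rw [hL] at h1
    rw [hC, hL, zPoly, algHom_C, algebraMap_eq, ← smul_eq_C_mul, map_smul]
    simp at h1
    rw [h1, hcard]
    simp
    ring
  rcases eq_or_ne x 0 with rfl | hx
  · rw [zero_pow hd.ne', zero_mul]
    rcases Nat.eq_zero_or_pos dμ with rfl | hdμ
    · rw [Finset.card_eq_zero] at hcard
      have := hscale 0 0
      rw [zero_smul, zero_pow hd.ne', zero_mul] at this
      rw [zero_pow two_ne_zero, zero_smul, hcard, Finset.sum_empty, sub_zero, this]
      simp
    · rw [zero_pow hdμ.ne', zero_mul]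
  · rw [eval_opHalf_mul_prod _ (hhyp.degreeOf_zPoly_le hv hvrank _) T hx, eval_zPoly, hcard]
    have : (x ^ 2) • e - ∑ i ∈ T, v i =
        x • (x • e + ∑ i, (if i ∈ T then -x⁻¹ else 0 : ℝ) • v i) := by
      ext j
      simp only [Pi.sub_apply, Pi.smul_apply, Pi.add_apply, Finset.sum_apply, smul_eq_mul,
        ite_mul, zero_mul, Finset.sum_ite_mem, Finset.univ_inter, ← Finset.mul_sum]
      field_simp
      ring
    rw [this, hscale]
    ring

end Identity

/-- If `a + bz + cw + dzw` has no zero with `z` and `w` in the closed upper half plane, then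
`a ≠ d`. -/
lemma ne_of_bilinear_ne_zero {a b c d : ℂ}
    (H : ∀ z w : ℂ, 0 ≤ z.im → 0 ≤ w.im → a + b * z + c * w + d * (z * w) ≠ 0) : a ≠ d := by
  rintro rfl
  have ha : a ≠ 0 := by simpa using H 0 0 (by simp) (by simp)
  have him : ∀ β : ℂ, (∀ z : ℂ, 0 ≤ z.im → a + β * z ≠ 0) → 0 ≤ (Complex.I - β / a).im := by
    intro β hβ
    by_contra! hlt
    simp only [Complex.sub_im, Complex.I_im] at hlt
    have hβ0 : β ≠ 0 := by rintro rfl; norm_num at hlt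
    refine hβ (-(β / a)⁻¹) ?_ (by field_simp; ring)
    rw [Complex.neg_im, Complex.inv_im, neg_div, neg_neg]
    exact div_nonneg (by linarith) (Complex.normSq_nonneg _)
  rcases eq_or_ne b 0 with rfl | hb
  · refine H (Complex.I - c / a) Complex.I
      (him c fun w hw => by simpa using H 0 w (by simp) hw) (by simp) ?_
    field_simp
    linear_combination a ^ 2 * Complex.I_sq
  rcases eq_or_ne c 0 with rfl | hc
  · refine H Complex.I (Complex.I - b / a) (by simp)
      (him b fun z hz => by simpa using H z 0 hz (by simp)) ?_
    field_simp
    linear_combination a ^ 2 * Complex.I_sq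
  obtain ⟨z, hz⟩ := IsAlgClosed.exists_pow_nat_eq (c / b) two_pos
  wlog him : 0 ≤ z.im generalizing z
  · exact this (-z) (by rw [neg_sq, hz]) (by simp at him ⊢; linarith)
  have hz0 : z ≠ 0 := by
    rintro rfl
    rw [zero_pow two_ne_zero, eq_comm, div_eq_zero_iff] at hz
    tauto
  refine H z (-z⁻¹) him ?_ ?_
  · rw [Complex.neg_im, Complex.inv_im, neg_div, neg_neg]
    exact div_nonneg him (Complex.normSq_nonneg _)
  · rw [eq_div_iff hb] at hz
    field_simp
    linear_combination hz

/-- Contracting each pair of variables `(zᵢ, wᵢ)` of the multiaffine polynomial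
`P(z) · ∑ μ(T) ∏_{i ∈ T} (x + wᵢ)` preserves nonvanishing. -/
lemma sum_mul_contract_ne_zero {n : ℕ} (μ : Finset (Fin n) → ℂ) {x : ℂ} (hx : x ≠ 0)
    (P : (Fin n → ℂ) → ℂ)
    (haff : ∀ z i s, P (Function.update z i s) = P (Function.update z i 0) +
      s * (P (Function.update z i 1) - P (Function.update z i 0)))
    (hP : ∀ z : Fin n → ℂ, (∀ i, 0 ≤ (z i).im) → P z ≠ 0)
    (hμ : ∀ w : Fin n → ℂ, (∀ i, 0 ≤ (w i).im) → ∑ T, μ T * ∏ i ∈ T, (x + w i) ≠ 0) :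
    ∑ T, μ T * x ^ T.card * P (fun i => if i ∈ T then -x⁻¹ else 0) ≠ 0 := by
  let q : Finset (Fin n) → Finset (Fin n) → (Fin n → ℂ) → Fin n → ℂ := fun T A z i =>
    if i ∈ A then (if i ∈ T then -x⁻¹ else 0) else z i
  let G : Finset (Fin n) → (Fin n → ℂ) → (Fin n → ℂ) → ℂ := fun A z w =>
    ∑ T, μ T * (∏ i ∈ T, if i ∈ A then x else x + w i) * P (q T A z)
  have key : ∀ A z w, (∀ i, 0 ≤ (z i).im) → (∀ i, 0 ≤ (w i).im) → G A z w ≠ 0 := by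
    intro A
    induction A using Finset.induction_on with
    | empty =>
      intro z w hz hw
      have : G ∅ z w = (∑ T, μ T * ∏ i ∈ T, (x + w i)) * P z := by
        rw [Finset.sum_mul]
        simp [G, q]
      rw [this]
      exact mul_ne_zero (hμ w hw) (hP z hz)
    | insert i A hi ih =>
      intro z w hz hw
      let κ : Finset (Fin n) → ℂ := fun T =>
        μ T * ∏ j ∈ T.erase i, if j ∈ A then x else x + w j
      let α : Finset (Fin n) → ℂ := fun T => P (Function.update (q T A z) i 0)
      let β : Finset (Fin n) → ℂ := fun T => P (Function.update (q T A z) i 1) - α T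
      have hq : ∀ T s, q T A (Function.update z i s) = Function.update (q T A z) i s := by
        intro T s
        ext j
        rcases eq_or_ne j i with rfl | hj
        · simp [q, hi]
        · simp [q, hj]
      have hq' : ∀ T, q T (insert i A) z =
          Function.update (q T A z) i (if i ∈ T then -x⁻¹ else 0) := by
        intro T
        ext j
        rcases eq_or_ne j i with rfl | hj
        · simp [q]
        · simp [q, hj]
      have hprod : ∀ (T A' : Finset (Fin n)) (w' : Fin n → ℂ),
          (∀ j, j ≠ i → ((if j ∈ A' then x else x + w' j) = if j ∈ A then x else x + w j)) →
          μ T * (∏ j ∈ T, if j ∈ A' then x else x + w' j) =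
            κ T * if i ∈ T then (if i ∈ A' then x else x + w' i) else 1 := by
        intro T A' w' hw'
        have herase : (∏ j ∈ T.erase i, if j ∈ A' then x else x + w' j) =
            ∏ j ∈ T.erase i, if j ∈ A then x else x + w j :=
          Finset.prod_congr rfl fun j hj => hw' j (Finset.ne_of_mem_erase hj)
        by_cases hT : i ∈ T
        · rw [if_pos hT, ← Finset.mul_prod_erase _ _ hT, herase]
          simp only [κ]
          ring
        · rw [if_neg hT, mul_one]
          simp only [κ]
          rw [← herase, Finset.erase_eq_of_notMem hT]
      have hGi : G (insert i A) z w = (∑ T, κ T * (if i ∈ T then x else 1) * α T) -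
          ∑ T, κ T * (if i ∈ T then 1 else 0) * β T := by
        rw [← Finset.sum_sub_distrib]
        refine Finset.sum_congr rfl fun T _ => ?_
        rw [hprod T (insert i A) w (fun j hj => by simp [hj]), hq', haff]
        simp only [Finset.mem_insert_self, if_true, α, β]
        by_cases hT : i ∈ T
        · simp only [hT, if_true]
          field_simp
          ring
        · simp [hT]
      rw [hGi]
      refine sub_ne_zero.2 (ne_of_bilinear_ne_zero
        (b := ∑ T, κ T * (if i ∈ T then x else 1) * β T)
        (c := ∑ T, κ T * (if i ∈ T then 1 else 0) * α T) fun s t hs ht => ?_)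
      have hG := ih (Function.update z i s) (Function.update w i t)
        (fun j => by rcases eq_or_ne j i with rfl | hj <;> simp [*])
        (fun j => by rcases eq_or_ne j i with rfl | hj <;> simp [*])
      convert hG using 1
      simp only [Finset.sum_mul, ← Finset.sum_add_distrib, G]
      refine Finset.sum_congr rfl fun T _ => ?_
      rw [hprod T A (Function.update w i t) (fun j hj => by simp [hj]), hq, haff]
      simp only [hi, if_false, Function.update_self, α, β]
      by_cases hT : i ∈ T
      · simp only [hT, if_true]
        ring
      · simp only [hT, if_false]
        ring
  have := key Finset.univ 0 0 (by simp) (by simp)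
  simpa [G, q] using this

theorem realRooted_mixed_characteristic {m d n : ℕ} {h : MvPolynomial (Fin m) ℝ}
    {e : Fin m → ℝ} {lam : (Fin m → ℝ) → Fin d → ℝ} (hhyp : IsHyperbolic h e lam)
    (μ : Finset (Fin n) → ℝ) (hSR : RealStable (genPoly μ))
    (dμ : ℕ) (hhom : (genPoly μ).IsHomogeneous dμ)
    (v : Fin n → Fin m → ℝ) (hv : ∀ i, InCone lam (v i))
    (hvrank : ∀ i, hrank lam (v i) ≤ 1) :
    RealRooted (∑ T : Finset (Fin n),
      Polynomial.C (μ T) * uniPoly h e (-(∑ i ∈ T, v i))) := by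
  intro y hy
  by_contra him
  obtain ⟨x, hx⟩ := IsAlgClosed.exists_pow_nat_eq y two_pos
  wlog hxim : 0 < x.im generalizing x
  · refine this (-x) (by rw [neg_sq, hx]) ?_
    have hne : x.im ≠ 0 := by
      intro h0
      apply him
      rw [← hx, sq, Complex.mul_im, h0]
      simp
    rw [Complex.neg_im]
    have := lt_of_le_of_ne (not_lt.1 hxim) hne
    linarith
  have hx0 : x ≠ 0 := by rintro rfl; simp at hxim
  refine sum_mul_contract_ne_zero (fun T => (μ T : ℂ)) hx0
    (fun z => aeval (x • cvec e + ∑ i, z i • cvec (v i)) h) ?_ ?_ ?_ ?_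
  · intro z i s
    obtain ⟨A, B, hAB⟩ := hhyp.exists_affine (hv i) (hvrank i)
    have hval : ∀ r : ℂ, aeval (x • cvec e + ∑ l, Function.update z i r l • cvec (v l)) h =
        aeval (x • cvec e + ∑ l ∈ Finset.univ.erase i, z l • cvec (v l)) A +
          r * aeval (x • cvec e + ∑ l ∈ Finset.univ.erase i, z l • cvec (v l)) B := by
      intro r
      rw [← hAB]
      refine congrArg (fun w => aeval w h) ?_
      rw [← Finset.add_sum_erase _ _ (Finset.mem_univ i), Function.update_self,
        Finset.sum_congr rfl fun l hl => by
          rw [Function.update_of_ne (Finset.ne_of_mem_erase hl)]]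
      ext j
      simp [cvec]
      ring
    simp only [hval]
    ring
  · intro z hz
    simpa [cvec_zero] using hhyp.stable Finset.univ hv hz 0 hxim
  · intro w hw
    have := hSR (fun i => x + w i) fun i => by
      rw [Complex.add_im]
      linarith [hw i]
    simpa [genPoly] using this
  · have hterm : ∀ T : Finset (Fin n), x ^ d * ((μ T : ℂ) * x ^ T.card *
        aeval (x • cvec e + ∑ i, (if i ∈ T then -x⁻¹ else 0 : ℂ) • cvec (v i)) h) =
        x ^ dμ * Polynomial.aeval y
          (Polynomial.C (μ T) * uniPoly h e (-(∑ i ∈ T, v i))) := by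
      intro T
      rcases eq_or_ne (μ T) 0 with h0 | h0
      · simp [h0]
      rw [card_eq_of_isHomogeneous_genPoly hhom h0, map_mul, Polynomial.aeval_C, aeval_uniPoly]
      have : (fun j => algebraMap ℝ ℂ (e j) * y + algebraMap ℝ ℂ ((-∑ i ∈ T, v i) j)) =
          x • (x • cvec e + ∑ i, (if i ∈ T then -x⁻¹ else 0 : ℂ) • cvec (v i)) := by
        ext j
        simp only [← hx, Pi.smul_apply, Pi.add_apply, Pi.neg_apply, Finset.sum_apply,
          smul_eq_mul, ite_mul, zero_mul, Finset.sum_ite_mem, Finset.univ_inter,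
          ← Finset.mul_sum, cvec, Complex.coe_algebraMap, Complex.ofReal_neg,
          Complex.ofReal_sum]
        field_simp
      rw [this, aeval_smul_of_isHomogeneous hhyp.1, Complex.coe_algebraMap]
      ring
    have hsum := Finset.sum_congr rfl fun T (_ : T ∈ Finset.univ) => hterm T
    rw [← Finset.mul_sum, ← Finset.mul_sum, ← map_sum, hy, mul_zero] at hsum
    exact (mul_eq_zero.1 hsum).resolve_left (pow_ne_zero _ hx0)

/-- The mixed characteristic polynomial of a strongly Rayleigh distribution equals the
multivariate polynomial with operators applied and `z = 0`; moreover it is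
real-rooted. -/
theorem sr_mixed_characteristic
    {m d n : ℕ} (h : MvPolynomial (Fin m) ℝ) (e : Fin m → ℝ)
    (lam : (Fin m → ℝ) → Fin d → ℝ)
    (hhyp : IsHyperbolic h e lam) (he : InOpenCone lam e)
    (μ : Finset (Fin n) → ℝ) (hprob : IsProbDist μ)
    (hSR : RealStable (genPoly μ))
    (dμ : ℕ) (hhom : (genPoly μ).IsHomogeneous dμ)
    (v : Fin n → Fin m → ℝ)
    (hv : ∀ i, InCone lam (v i))
    (hvrank : ∀ i, hrank lam (v i) ≤ 1) :
    (∀ x : ℝ,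
      x ^ dμ * ∑ T : Finset (Fin n), μ T * eval ((x ^ 2) • e - ∑ i ∈ T, v i) h
        = x ^ d * eval (0 : Fin n → ℝ)
            (opHalf (zPoly h (x • e) v * shiftPoly (genPoly μ) x)))
    ∧ RealRooted (∑ T : Finset (Fin n),
        Polynomial.C (μ T) * uniPoly h e (-(∑ i ∈ T, v i))) := by
  exact ⟨mixed_characteristic_identity hhyp μ dμ hhom v hv hvrank,
    realRooted_mixed_characteristic hhyp μ hSR dμ hhom v hv hvrank⟩
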